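/- Define h_m(p) = −a_m b_m [Σ_{k∈𝒴_m}(ξBT/D_m)log₂(1 + G_{k,k}p_k/σ²) + A_m]^{−b_m−1}. Let p, p' have nonnegative entries and suppose β_m·Ξ_m(q) ≤ μ₀ for every q on the line segment joining p and p'. Then |h_m(p) − h_m(p')| ≤ (a_m b_m (b_m+1) ξBT H_m/(D_m ln 2 · σ²))·(μ₀/(β_m a_m))^{1+2/b_m}·‖p − p'‖₂. -/

import Mathlib

open Finset

/-- Total number of collected samples (minus A_m) of task m in the asymptotic regime:
Σ_{k∈Y} (ξBT/D_m) log₂(1 + G_kk p_k/σ²). -/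
noncomputable def Srate {K : ℕ} (G : Fin K → ℝ) (σ2 ξ B T Dm : ℝ)
    (Y : Finset (Fin K)) (p : Fin K → ℝ) : ℝ :=
  ∑ k ∈ Y, ξ * B * T / Dm * Real.logb 2 (1 + G k * p k / σ2)

/-- Asymptotic classification error Ξ_m(p) of task m. -/
noncomputable def Xi {K : ℕ} (G : Fin K → ℝ) (σ2 ξ B T Dm Am am bm : ℝ)
    (Y : Finset (Fin K)) (p : Fin K → ℝ) : ℝ :=
  am * (Srate G σ2 ξ B T Dm Y p + Am) ^ (-bm)

/-- Partial derivative ∂Ξ_m/∂p_j (closed form, eq. (24) of the paper). -/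
noncomputable def dXi {K : ℕ} (G : Fin K → ℝ) (σ2 ξ B T Dm Am am bm : ℝ)
    (Y : Finset (Fin K)) (p : Fin K → ℝ) (j : Fin K) : ℝ :=
  -(am * bm * (ξ * B * T) * (if j ∈ Y then (1 : ℝ) else 0)
      / (Dm * Real.log 2 * (σ2 / G j + p j)))
    * (Srate G σ2 ξ B T Dm Y p + Am) ^ (-bm - 1)

/-- The constant H_m = ‖(𝟙_{Y}(1) G_11, …, 𝟙_{Y}(K) G_KK)‖₂. -/
noncomputable def Hconst {K : ℕ} (G : Fin K → ℝ) (Y : Finset (Fin K)) : ℝ :=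
  Real.sqrt (∑ j, (if j ∈ Y then G j else 0) ^ 2)

/-- The auxiliary function h_m(p) = −a_m b_m [Σ_{k∈Y}(ξBT/D_m)log₂(1+G_kk p_k/σ²)+A_m]^{−b_m−1}. -/
noncomputable def hfun {K : ℕ} (G : Fin K → ℝ) (σ2 ξ B T Dm Am am bm : ℝ)
    (Y : Finset (Fin K)) (p : Fin K → ℝ) : ℝ :=
  -(am * bm) * (Srate G σ2 ξ B T Dm Y p + Am) ^ (-bm - 1)

lemma aux_rpow (b C x y : ℝ) (hb : 0 < b) (hx : 0 < x) (hxy : x ≤ y)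
    (hC : x ^ (-b - 2) ≤ C) :
    |y ^ (-b - 1) - x ^ (-b - 1)| ≤ (b + 1) * C * |y - x| := by
  have := Convex.norm_image_sub_le_of_norm_hasDerivWithin_le (𝕜 := ℝ)
    (f := fun z : ℝ => z ^ (-b - 1)) (f' := fun z => (-b - 1) * z ^ (-b - 1 - 1))
    (C := (b + 1) * C) (s := Set.Ici x) (x := x) (y := y) ?_ ?_ (convex_Ici x)
    (Set.mem_Ici.2 le_rfl) (Set.mem_Ici.2 hxy)
  · simpa [Real.norm_eq_abs] using this
  · intro z hz
    have hz0 : 0 < z := lt_of_lt_of_le hx hz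
    exact (Real.hasDerivAt_rpow_const (Or.inl hz0.ne')).hasDerivWithinAt
  · intro z hz
    have hz0 : 0 < z := lt_of_lt_of_le hx hz
    have h1 : z ^ (-b - 2) ≤ x ^ (-b - 2) :=
      Real.rpow_le_rpow_of_nonpos hx hz (by linarith)
    have h2 : (0:ℝ) < z ^ (-b - 2) := Real.rpow_pos_of_pos hz0 _
    have e : -b - 1 - 1 = -b - 2 := by ring
    rw [Real.norm_eq_abs, abs_mul, e, abs_of_pos h2, abs_of_neg (by linarith)]
    have : -(-b - 1) = b + 1 := by ring
    rw [this]
    exact mul_le_mul_of_nonneg_left (h1.trans hC) (by linarith)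

lemma aux_pow (b c x : ℝ) (hb : 0 < b) (hx : 0 < x) (h : x ^ (-b) ≤ c) :
    x ^ (-b - 2) ≤ c ^ (1 + 2 / b) := by
  have e : x ^ (-b - 2) = (x ^ (-b)) ^ (1 + 2 / b) := by
    rw [← Real.rpow_mul hx.le]
    congr 1
    field_simp
    ring
  rw [e]
  exact Real.rpow_le_rpow (Real.rpow_pos_of_pos hx _).le h (by positivity)

lemma aux_sym (b c x y : ℝ) (hb : 0 < b) (hx : 0 < x) (hy : 0 < y)
    (h : x ^ (-b) ≤ c) (h' : y ^ (-b) ≤ c) :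
    |x ^ (-b - 1) - y ^ (-b - 1)| ≤ (b + 1) * c ^ (1 + 2 / b) * |x - y| := by
  rcases le_total x y with hxy | hxy
  · rw [abs_sub_comm, abs_sub_comm x y]
    exact aux_rpow b _ x y hb hx hxy (aux_pow b c x hb hx h)
  · exact aux_rpow b _ y x hb hy hxy (aux_pow b c y hb hy h')

lemma aux_log1 (u v : ℝ) (hu : 0 ≤ u) (hv : 0 ≤ v) :
    Real.log (1 + u) - Real.log (1 + v) ≤ |u - v| := by
  rw [← Real.log_div (by positivity) (by positivity)]
  have h := Real.log_le_sub_one_of_pos (x := (1 + u) / (1 + v)) (by positivity)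
  have e : (1 + u) / (1 + v) - 1 = (u - v) / (1 + v) := by
    field_simp
    ring
  rw [e] at h
  refine h.trans ?_
  rw [div_le_iff₀ (by positivity)]
  nlinarith [le_abs_self (u - v), abs_nonneg (u - v)]

lemma aux_log (u v : ℝ) (hu : 0 ≤ u) (hv : 0 ≤ v) :
    |Real.log (1 + u) - Real.log (1 + v)| ≤ |u - v| := by
  rw [abs_le]
  have h1 := aux_log1 u v hu hv
  have h2 := aux_log1 v u hv hu
  rw [abs_sub_comm] at h2
  constructor <;> linarith

lemma aux_S {K : ℕ} (G : Fin K → ℝ) (σ2 ξ B T Dm : ℝ) (Y : Finset (Fin K))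
    (p p' : Fin K → ℝ)
    (hG : ∀ k, 0 < G k) (hσ : 0 < σ2) (hξ : 0 < ξ) (hB : 0 < B) (hT : 0 < T)
    (hD : 0 < Dm) (hp : ∀ k, 0 ≤ p k) (hp' : ∀ k, 0 ≤ p' k) :
    |Srate G σ2 ξ B T Dm Y p - Srate G σ2 ξ B T Dm Y p'| ≤
      (ξ * B * T) / (Dm * Real.log 2 * σ2) *
        (Hconst G Y * Real.sqrt (∑ k, (p k - p' k) ^ 2)) := by
  have hl : 0 < Real.log 2 := Real.log_pos (by norm_num)
  have hcs : ∑ k ∈ Y, G k * |p k - p' k| ≤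
      Hconst G Y * Real.sqrt (∑ k, (p k - p' k) ^ 2) := by
    have h := Real.sum_mul_le_sqrt_mul_sqrt Finset.univ
      (fun k => if k ∈ Y then G k else 0) (fun k => |p k - p' k|)
    simpa [Hconst, sq_abs, ite_mul, Finset.sum_ite_mem] using h
  refine le_trans ?_ (mul_le_mul_of_nonneg_left hcs (by positivity))
  unfold Srate
  rw [← Finset.sum_sub_distrib, Finset.mul_sum]
  refine (Finset.abs_sum_le_sum_abs _ _).trans (Finset.sum_le_sum fun k _ => ?_)
  have h := aux_log (G k * p k / σ2) (G k * p' k / σ2)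
    (div_nonneg (mul_nonneg (hG k).le (hp k)) hσ.le)
    (div_nonneg (mul_nonneg (hG k).le (hp' k)) hσ.le)
  have e : G k * p k / σ2 - G k * p' k / σ2 = G k / σ2 * (p k - p' k) := by ring
  rw [e, abs_mul, abs_of_pos (div_pos (hG k) hσ)] at h
  have e2 : ξ * B * T / Dm * Real.logb 2 (1 + G k * p k / σ2) -
      ξ * B * T / Dm * Real.logb 2 (1 + G k * p' k / σ2) =
      ξ * B * T / (Dm * Real.log 2) *
        (Real.log (1 + G k * p k / σ2) - Real.log (1 + G k * p' k / σ2)) := by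
    unfold Real.logb
    field_simp
  have hc : 0 < ξ * B * T / (Dm * Real.log 2) := by positivity
  rw [e2, abs_mul, abs_of_pos hc]
  refine (mul_le_mul_of_nonneg_left h hc.le).trans (le_of_eq ?_)
  field_simp

lemma aux_S0 {K : ℕ} (G : Fin K → ℝ) (σ2 ξ B T Dm : ℝ) (Y : Finset (Fin K))
    (p : Fin K → ℝ)
    (hG : ∀ k, 0 < G k) (hσ : 0 < σ2) (hξ : 0 < ξ) (hB : 0 < B) (hT : 0 < T)
    (hD : 0 < Dm) (hp : ∀ k, 0 ≤ p k) : 0 ≤ Srate G σ2 ξ B T Dm Y p := by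
  unfold Srate
  refine Finset.sum_nonneg fun k _ => mul_nonneg (by positivity) ?_
  refine Real.logb_nonneg (by norm_num) ?_
  have := div_nonneg (mul_nonneg (hG k).le (hp k)) hσ.le
  linarith

/-- Lipschitz bound on h_m along a segment where the error level holds. -/
theorem hfun_lipschitz {K : ℕ} [NeZero K]
    (G : Fin K → ℝ) (σ2 ξ B T Dm Am am bm βm μ0 : ℝ) (Y : Finset (Fin K))
    (p p' : Fin K → ℝ)
    (hG : ∀ k, 0 < G k) (hσ : 0 < σ2) (hξ : 0 < ξ) (hB : 0 < B) (hT : 0 < T)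
    (hD : 0 < Dm) (hA : 0 < Am) (ha : 0 < am) (hb : 0 < bm) (hβ : 1 ≤ βm)
    (hμ0 : 0 < μ0) (hY : Y.Nonempty) (hp : ∀ k, 0 ≤ p k) (hp' : ∀ k, 0 ≤ p' k)
    (hseg : ∀ q ∈ segment ℝ p p', βm * Xi G σ2 ξ B T Dm Am am bm Y q ≤ μ0) :
    |hfun G σ2 ξ B T Dm Am am bm Y p - hfun G σ2 ξ B T Dm Am am bm Y p'|
      ≤ am * bm * (bm + 1) * (ξ * B * T) * Hconst G Y / (Dm * Real.log 2 * σ2)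
          * (μ0 / (βm * am)) ^ (1 + 2 / bm)
          * Real.sqrt (∑ k, (p k - p' k) ^ 2) := by
  have hβ0 : 0 < βm := by linarith
  have key : ∀ q ∈ segment ℝ p p',
      (Srate G σ2 ξ B T Dm Y q + Am) ^ (-bm) ≤ μ0 / (βm * am) := by
    intro q hq
    have h := hseg q hq
    unfold Xi at h
    rw [le_div_iff₀ (by positivity)]
    linarith
  have hx := aux_S0 G σ2 ξ B T Dm Y p hG hσ hξ hB hT hD hp
  have hy := aux_S0 G σ2 ξ B T Dm Y p' hG hσ hξ hB hT hD hp'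
  have h1 := aux_sym bm (μ0 / (βm * am)) _ _ hb (by linarith) (by linarith)
    (key p (left_mem_segment ℝ p p')) (key p' (right_mem_segment ℝ p p'))
  have h2 := aux_S G σ2 ξ B T Dm Y p p' hG hσ hξ hB hT hD hp hp'
  rw [add_sub_add_right_eq_sub] at h1
  have hc : 0 ≤ (bm + 1) * (μ0 / (βm * am)) ^ (1 + 2 / bm) := by positivity
  have h3 := h1.trans (mul_le_mul_of_nonneg_left h2 hc)
  have h4 := mul_le_mul_of_nonneg_left h3 (mul_pos ha hb).le
  unfold hfun
  rw [← mul_sub, abs_mul, abs_neg, abs_of_pos (mul_pos ha hb)]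
  refine h4.trans (le_of_eq ?_)
  ring
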